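/- arXiv:1912.10943 — 11 statements merged into one kernel-verified Lean document; each statement's English description precedes it below -/
import Mathlib

section
/- For every natural number m, the Lucas polynomial {m+1} equals the sum, over all lists T of elements of {1,2} whose entries sum to m (a finite collection), of the weight wt(T) = ∏_{i ∈ T} s_i. (Combinatorially: {m+1} is the generating polynomial for tilings of a strip of m cells by monominoes, each weighted s_1, and dominoes, each weighted s_2.) -/
open MvPolynomial Finset

/-- The Lucas polynomials in `ℤ[S]`, where `s₁ = X 1` and `s₂ = X 2`:
`{0} = 0`, `{1} = 1`, `{m} = s₁·{m−1} + s₂·{m−2}`. -/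
noncomputable def luc : ℕ → MvPolynomial ℕ ℤ
  | 0 => 0
  | 1 => 1
  | m + 2 => X 1 * luc (m + 1) + X 2 * luc m

/-- The tilings of a strip of `m` cells: lists with entries in `{1, 2}` summing to `m`. -/
def tilings : ℕ → Finset (List ℕ)
  | 0 => {[]}
  | 1 => {[1]}
  | m + 2 => (tilings (m + 1)).image (List.cons 1) ∪ (tilings m).image (List.cons 2)

theorem mem_tilings (m : ℕ) (T : List ℕ) :
    T ∈ tilings m ↔ (∀ i ∈ T, i = 1 ∨ i = 2) ∧ T.sum = m := by
  induction m using tilings.induct generalizing T with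
  | case1 =>
    rcases T with _ | ⟨a, T⟩
    · simp [tilings]
    · simp [tilings]
      grind
  | case2 =>
    rcases T with _ | ⟨a, _ | ⟨b, T⟩⟩
    · simp [tilings]
    · simp [tilings]
      grind
    · simp [tilings]
      grind
  | case3 m ih₁ ih₂ =>
    rcases T with _ | ⟨a, T⟩
    · simp [tilings]
    · simp only [tilings, mem_union, mem_image, List.cons.injEq, ih₁, ih₂, List.sum_cons,
        List.forall_mem_cons]
      grind

theorem luc_succ_eq_sum_tilings (m : ℕ) :
    luc (m + 1) = ∑ T ∈ tilings m, (T.map fun i => (X i : MvPolynomial ℕ ℤ)).prod := by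
  induction m using tilings.induct with
  | case1 => simp [tilings, luc]
  | case2 => simp [tilings, luc]
  | case3 m ih₁ ih₂ =>
    have hdisj : Disjoint ((tilings (m + 1)).image (List.cons 1))
        ((tilings m).image (List.cons 2)) := by
      rw [disjoint_left]
      grind
    rw [luc, ih₁, ih₂, tilings, sum_union hdisj, sum_image List.cons_injective.injOn,
      sum_image List.cons_injective.injOn]
    simp [mul_sum]

/-- `{m+1}` equals the sum, over all lists `T` with entries in `{1,2}` summing to `m`,
of `wt(T) = ∏_{i ∈ T} s_i`. -/
theorem lucas_eq_sum_tilings (m : ℕ) (𝒯 : Finset (List ℕ))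
    (h𝒯 : ∀ T : List ℕ, T ∈ 𝒯 ↔ ((∀ i ∈ T, i = 1 ∨ i = 2) ∧ T.sum = m)) :
    luc (m + 1) = ∑ T ∈ 𝒯, (T.map fun i => (X i : MvPolynomial ℕ ℤ)).prod := by
  obtain rfl : 𝒯 = tilings m := by
    ext T
    rw [h𝒯, mem_tilings]
  exact luc_succ_eq_sum_tilings m
end

section
/- Let r be a positive integer. For every natural number m, the r-Lucas polynomial {m+1}_r equals the sum, over all lists T consisting of (m mod r) copies of 1 followed by a list of entries from {r, 2r}, with total entry sum equal to m, of the weight wt(T) = ∏_{i ∈ T} s_i. -/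
open MvPolynomial Finset

/-- The lists with entries in `{r, 2 * r}` and sum `q * r`. -/
def blockTilings (r : ℕ) : ℕ → Finset (List ℕ)
  | 0 => {[]}
  | 1 => {[r]}
  | q + 2 => (blockTilings r (q + 1)).image (List.cons r) ∪
      (blockTilings r q).image (List.cons (2 * r))

theorem mem_blockTilings {r : ℕ} (hr : 0 < r) (q : ℕ) (t : List ℕ) :
    t ∈ blockTilings r q ↔ (∀ i ∈ t, i = r ∨ i = 2 * r) ∧ t.sum = q * r := by
  induction q using blockTilings.induct generalizing t with
  | case1 =>
    rcases t with _ | ⟨a, t⟩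
    · simp [blockTilings]
    · simp [blockTilings]
      grind
  | case2 =>
    rcases t with _ | ⟨a, _ | ⟨b, t⟩⟩
    · simp [blockTilings, hr.ne]
    · simp +contextual [blockTilings]
    · simp only [blockTilings, mem_singleton, List.forall_mem_cons, List.sum_cons]
      grind
  | case3 q ih₁ ih₀ =>
    rcases t with _ | ⟨a, t⟩
    · simp [blockTilings, hr.ne']
    · simp only [blockTilings, mem_union, mem_image, List.cons.injEq, ih₁, ih₀,
        List.forall_mem_cons, List.sum_cons, add_mul]
      grind

theorem sum_blockTilings_add_two {R : Type*} [CommSemiring R] {r : ℕ} (hr : 0 < r)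
    (w : ℕ → R) (q : ℕ) :
    ∑ t ∈ blockTilings r (q + 2), (t.map w).prod =
      w r * ∑ t ∈ blockTilings r (q + 1), (t.map w).prod +
        w (2 * r) * ∑ t ∈ blockTilings r q, (t.map w).prod := by
  have hdisj : Disjoint ((blockTilings r (q + 1)).image (List.cons r))
      ((blockTilings r q).image (List.cons (2 * r))) := by
    rw [Finset.disjoint_left]
    simp only [mem_image]
    grind
  rw [blockTilings, sum_union hdisj, sum_image List.cons_injective.injOn,
    sum_image List.cons_injective.injOn]
  simp [mul_sum]

theorem rLucas_eq_pow_mul_sum_blockTilings {R : Type*} [CommSemiring R] {r : ℕ} (hr : 0 < r)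
    (w L : ℕ → R) (hL0 : L 0 = 0) (hL1 : ∀ i, 1 ≤ i → i ≤ r → L i = w 1 ^ (i - 1))
    (hLrec : ∀ k, r < k → L k = w r * L (k - r) + w (2 * r) * L (k - 2 * r))
    {c : ℕ} (hc : c < r) (q : ℕ) :
    L (c + q * r + 1) = w 1 ^ c * ∑ t ∈ blockTilings r q, (t.map w).prod := by
  induction q using blockTilings.induct with
  | case1 => simp [blockTilings, hL1 (c + 1) (by omega) (by omega)]
  | case2 =>
    rw [hLrec _ (by omega), show c + 1 * r + 1 - r = c + 1 by omega,
      show c + 1 * r + 1 - 2 * r = 0 by omega, hL0, hL1 (c + 1) (by omega) (by omega)]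
    simp [blockTilings, mul_comm]
  | case3 q ih₁ ih₀ =>
    have h₁ : c + (q + 2) * r + 1 - r = c + (q + 1) * r + 1 := by
      simp only [add_mul]; omega
    have h₀ : c + (q + 2) * r + 1 - 2 * r = c + q * r + 1 := by
      simp only [add_mul]; omega
    rw [hLrec (c + (q + 2) * r + 1) (by simp only [add_mul]; omega), h₁, h₀, ih₁, ih₀,
      sum_blockTilings_add_two hr]
    ring

/-- The `r`-Lucas polynomial `{m+1}_r` (given by its defining recursion as hypotheses on `L`)
equals the sum, over all lists `T` consisting of `m mod r` copies of `1` followed by a list of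
entries from `{r, 2r}`, with total sum `m`, of `wt(T) = ∏_{i ∈ T} s_i`. -/
theorem rLucas_eq_sum_tilings (r : ℕ) (hr : 0 < r) (m : ℕ)
    (L : ℕ → MvPolynomial ℕ ℤ)
    (hL0 : L 0 = 0)
    (hL1 : ∀ i, 1 ≤ i → i ≤ r → L i = X 1 ^ (i - 1))
    (hLrec : ∀ k, r < k → L k = X r * L (k - r) + X (2 * r) * L (k - 2 * r))
    (𝒯 : Finset (List ℕ))
    (h𝒯 : ∀ T : List ℕ, T ∈ 𝒯 ↔ ∃ t : List ℕ,
      (∀ i ∈ t, i = r ∨ i = 2 * r) ∧ T = List.replicate (m % r) 1 ++ t ∧ T.sum = m) :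
    L (m + 1) = ∑ T ∈ 𝒯, (T.map fun i => (X i : MvPolynomial ℕ ℤ)).prod := by
  have h𝒯_eq : 𝒯 = (blockTilings r (m / r)).image (List.replicate (m % r) 1 ++ ·) := by
    ext T
    have hm := Nat.div_add_mod' m r
    simp only [h𝒯, mem_image, mem_blockTilings hr]
    refine exists_congr fun t => ⟨?_, ?_⟩
    · rintro ⟨ht, rfl, hsum⟩
      simp only [List.sum_append, List.sum_replicate, smul_eq_mul, mul_one] at hsum
      exact ⟨⟨ht, by omega⟩, rfl⟩
    · rintro ⟨⟨ht, hsum⟩, rfl⟩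
      refine ⟨ht, rfl, ?_⟩
      simp only [List.sum_append, List.sum_replicate, smul_eq_mul, mul_one]
      omega
  have hL := rLucas_eq_pow_mul_sum_blockTilings hr X L hL0 hL1 hLrec (Nat.mod_lt m hr) (m / r)
  rw [Nat.mod_add_div'] at hL
  rw [hL, h𝒯_eq, sum_image (List.append_right_injective _).injOn]
  simp [mul_sum]
end

section
/- Let r be a positive integer and let n ≤ m be natural numbers. Set a = n mod r and h = (m − n) mod r, and define g = a·h if a + h ≤ r and g = (r − a)·(r − h) if a + h > r. Then ∑_{i=1}^{n} ((i−1) mod r) + ∑_{i=1}^{m−n} ((i−1) mod r) + g = ∑_{i=1}^{m} ((i−1) mod r). (Equivalently, the quantity γ_r(m,n) = ∑_{i=1}^{m} ((i−1) mod r) − ∑_{i=1}^{n} ((i−1) mod r) − ∑_{i=1}^{m−n} ((i−1) mod r) is a nonnegative integer equal to g.) -/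
open Finset

/-- Twice the sum of the residues modulo `r` of the first `r * q + a` naturals, for `a ≤ r`. -/
theorem two_mul_sum_range_mod (r q a : ℕ) (ha : a ≤ r) :
    2 * ((∑ i ∈ Finset.range (r * q + a), i % r : ℕ) : ℤ) = q * (r * (r - 1)) + a * (a - 1) := by
  induction q generalizing a with
  | zero =>
    induction a with
    | zero => simp
    | succ a ih =>
      have ih := ih (by omega)
      rw [← Nat.add_assoc, Finset.sum_range_succ, Nat.mul_add_mod, Nat.mod_eq_of_lt (by omega)]
      push_cast at ih ⊢
      linarith
  | succ q ihq =>
    induction a with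
    | zero =>
      have h := ihq r le_rfl
      rw [Nat.add_zero, Nat.mul_succ, h]
      push_cast
      ring
    | succ a ih =>
      have ih := ih (by omega)
      rw [← Nat.add_assoc, Finset.sum_range_succ, Nat.mul_add_mod, Nat.mod_eq_of_lt (by omega)]
      push_cast at ih ⊢
      linarith

/-- The exponent `γ_r(m,n) = ∑_{i=1}^{m} ((i−1) mod r) − ∑_{i=1}^{n} ((i−1) mod r)
− ∑_{i=1}^{m−n} ((i−1) mod r)` is a nonnegative integer, equal to `a·h` if `a + h ≤ r` and
to `(r−a)·(r−h)` otherwise, where `a = n mod r` and `h = (m−n) mod r`. -/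
theorem gamma_formula (r m n : ℕ) (hr : 0 < r) (hnm : n ≤ m) :
    (∑ i ∈ Finset.range n, i % r) + (∑ i ∈ Finset.range (m - n), i % r)
      + (if n % r + (m - n) % r ≤ r then (n % r) * ((m - n) % r)
         else (r - n % r) * (r - (m - n) % r))
    = ∑ i ∈ Finset.range m, i % r := by
  obtain ⟨k, rfl⟩ := Nat.exists_eq_add_of_le hnm
  rw [Nat.add_sub_cancel_left]
  have ha := Nat.mod_lt n hr
  have hh := Nat.mod_lt k hr
  have en := Nat.div_add_mod n r
  have ek := Nat.div_add_mod k r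
  have sn := two_mul_sum_range_mod r (n / r) (n % r) ha.le
  have sk := two_mul_sum_range_mod r (k / r) (k % r) hh.le
  rw [en] at sn
  rw [ek] at sk
  generalize n % r = a at *
  generalize k % r = h at *
  generalize n / r = q at *
  generalize k / r = p at *
  split_ifs with hle <;> zify
  · have sm := two_mul_sum_range_mod r (q + p) (a + h) hle
    rw [show r * (q + p) + (a + h) = n + k by rw [← en, ← ek]; ring] at sm
    push_cast at sn sk sm ⊢
    linarith
  · obtain ⟨c, hc⟩ := Nat.exists_eq_add_of_le (show r ≤ a + h by omega)
    have sm := two_mul_sum_range_mod r (q + p + 1) c (by omega)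
    rw [show r * (q + p + 1) + c = n + k by rw [← en, ← ek]; linarith] at sm
    have hc' : (c : ℤ) = a + h - r := by omega
    rw [hc'] at sm
    push_cast [ha.le, hh.le] at sn sk sm ⊢
    linarith
end

section
/- Let r be a positive integer and m ≥ 1 a natural number. Then {m}_r = s_1^{ε_r(m) − 1} · φ_r({⌈m/r⌉}), where {⌈m/r⌉} is the Lucas polynomial with index ⌈m/r⌉. (Note ⌈m/r⌉ = ((m−1) div r) + 1.) -/
open MvPolynomial Finset

/-- `φ_r`, the `ℤ`-algebra endomorphism of `ℤ[S]` sending each variable `s_i` to `s_{r·i}`. -/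
noncomputable def phi (r : ℕ) : MvPolynomial ℕ ℤ →ₐ[ℤ] MvPolynomial ℕ ℤ :=
  aeval fun i => X (r * i)

theorem phi_luc_add_two (r q : ℕ) :
    phi r (luc (q + 2)) = X r * phi r (luc (q + 1)) + X (2 * r) * phi r (luc q) := by
  simp [luc, phi, mul_comm r 2]

/-- The claimed formula at `m = r q + j + 1` with `j < r`. -/
theorem rLucas_mul_add_succ (r : ℕ) (L : ℕ → MvPolynomial ℕ ℤ) (hL0 : L 0 = 0)
    (hL1 : ∀ i, 1 ≤ i → i ≤ r → L i = X 1 ^ (i - 1))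
    (hLrec : ∀ k, r < k → L k = X r * L (k - r) + X (2 * r) * L (k - 2 * r))
    (j : ℕ) (hj : j < r) (q : ℕ) :
    L (r * q + j + 1) = X 1 ^ j * phi r (luc (q + 1)) := by
  induction q using Nat.twoStepInduction with
  | zero => simp [hL1 (j + 1) (by omega) hj, luc]
  | one =>
    have h1 : r * 1 + j + 1 - r = j + 1 := by omega
    have h2 : r * 1 + j + 1 - 2 * r = 0 := by omega
    rw [hLrec _ (by omega), h1, h2, hL0, hL1 (j + 1) (by omega) hj, phi_luc_add_two]
    simp [luc, mul_comm]
  | more q ih0 ih1 =>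
    have h : r * (q + 2) = r * q + 2 * r := by ring
    have h' : r * (q + 1) = r * q + r := by ring
    have h1 : r * (q + 2) + j + 1 - r = r * (q + 1) + j + 1 := by omega
    have h2 : r * (q + 2) + j + 1 - 2 * r = r * q + j + 1 := by omega
    rw [hLrec _ (by omega), h1, h2, ih0, ih1, phi_luc_add_two r (q + 1)]
    ring

/-- For `m ≥ 1`, `{m}_r = s₁^{ε_r(m)−1} · φ_r({⌈m/r⌉})`, where `ε_r(m) − 1 = (m−1) mod r`
and `⌈m/r⌉ = (m + r − 1) div r`. -/
theorem rLucas_eq_phi_lucas (r : ℕ) (hr : 0 < r) (m : ℕ) (hm : 1 ≤ m)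
    (L : ℕ → MvPolynomial ℕ ℤ)
    (hL0 : L 0 = 0)
    (hL1 : ∀ i, 1 ≤ i → i ≤ r → L i = X 1 ^ (i - 1))
    (hLrec : ∀ k, r < k → L k = X r * L (k - r) + X (2 * r) * L (k - 2 * r)) :
    L m = X 1 ^ ((m - 1) % r) * phi r (luc ((m + r - 1) / r)) := by
  have hceil : (m + r - 1) / r = (m - 1) / r + 1 := by
    rw [← Nat.add_div_right _ hr]
    congr 1
    omega
  have hdiv : r * ((m - 1) / r) + (m - 1) % r + 1 = m := by
    rw [Nat.div_add_mod]
    omega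
  have key := rLucas_mul_add_succ r L hL0 hL1 hLrec _ (Nat.mod_lt (m - 1) hr) ((m - 1) / r)
  rwa [hdiv, ← hceil] at key
end

section
/- Let r be a positive integer, m ≥ 1 a natural number, d = (m−1) div r, and ε = ε_r(m). Then ∏_{j=0}^{d} {m − j·r}_r = s_1^{(ε−1)·(d+1)} · φ_r({d+1}!), where {d+1}! is the Lucas factorial. -/
open MvPolynomial Finset

/-- The Lucas factorial `{m}! = {m}·{m−1}⋯{1}`, with `{0}! = 1`. -/
noncomputable def lucFact (m : ℕ) : MvPolynomial ℕ ℤ :=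
  ∏ j ∈ Finset.range m, luc (j + 1)

/-- Each `r`-Lucas polynomial factors as `{k·r + e + 1}_r = s₁^e · φ_r({k+1})` for `e < r`. -/
theorem rLucas_eq_pow_mul_phi_luc (r : ℕ) (L : ℕ → MvPolynomial ℕ ℤ)
    (hL0 : L 0 = 0)
    (hL1 : ∀ i, 1 ≤ i → i ≤ r → L i = X 1 ^ (i - 1))
    (hLrec : ∀ k, r < k → L k = X r * L (k - r) + X (2 * r) * L (k - 2 * r))
    {e : ℕ} (he : e < r) (k : ℕ) :
    L (k * r + e + 1) = X 1 ^ e * phi r (luc (k + 1)) := by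
  have phi_X (i : ℕ) : phi r (X i) = X (r * i) := by simp [phi]
  induction k using Nat.twoStepInduction with
  | zero =>
    rw [zero_mul, zero_add, hL1 _ (by omega) (by omega)]
    simp [luc]
  | one =>
    rw [hLrec _ (by omega), show 1 * r + e + 1 - r = e + 1 by omega,
      show 1 * r + e + 1 - 2 * r = 0 by omega, hL0, hL1 _ (by omega) (by omega)]
    simp [luc, phi_X]
    ring
  | more k ih₀ ih₁ =>
    have h₁ : (k + 2) * r = (k + 1) * r + r := by ring
    have h₂ : (k + 2) * r = k * r + 2 * r := by ring
    rw [hLrec _ (by omega), show (k + 2) * r + e + 1 - r = (k + 1) * r + e + 1 by omega,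
      show (k + 2) * r + e + 1 - 2 * r = k * r + e + 1 by omega, ih₀, ih₁,
      show luc (k + 2 + 1) = X 1 * luc (k + 1 + 1) + X 2 * luc (k + 1) from rfl,
      map_add, map_mul, map_mul, phi_X, phi_X, mul_one, mul_comm r 2]
    ring

/-- For `m ≥ 1`, with `d = (m−1) div r` and `ε = ε_r(m) = ((m−1) mod r) + 1`,
`∏_{j=0}^{d} {m − j·r}_r = s₁^{(ε−1)(d+1)} · φ_r({d+1}!)`. -/
theorem rLucas_prod_eq_phi_lucasFact (r : ℕ) (hr : 0 < r) (m : ℕ) (hm : 1 ≤ m)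
    (L : ℕ → MvPolynomial ℕ ℤ)
    (hL0 : L 0 = 0)
    (hL1 : ∀ i, 1 ≤ i → i ≤ r → L i = X 1 ^ (i - 1))
    (hLrec : ∀ k, r < k → L k = X r * L (k - r) + X (2 * r) * L (k - 2 * r)) :
    ∏ j ∈ Finset.range ((m - 1) / r + 1), L (m - j * r)
      = X 1 ^ ((m - 1) % r * ((m - 1) / r + 1)) * phi r (lucFact ((m - 1) / r + 1)) := by
  have hdiv : (m - 1) / r * r + (m - 1) % r + 1 = m := by
    rw [Nat.div_add_mod']
    omega
  have he := Nat.mod_lt (m - 1) hr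
  generalize (m - 1) / r = d at *
  generalize (m - 1) % r = e at *
  rw [lucFact, map_prod, pow_mul]
  nth_rw 2 [← card_range (d + 1)]
  rw [← prod_const, ← prod_mul_distrib, ← prod_range_reflect]
  refine prod_congr rfl fun j hj => ?_
  obtain ⟨i, rfl⟩ := Nat.exists_eq_add_of_le (Nat.lt_succ_iff.mp (mem_range.mp hj))
  rw [← rLucas_eq_pow_mul_phi_luc r L hL0 hL1 hLrec he]
  congr 1
  rw [show j + i + 1 - 1 - j = i by omega]
  rw [add_mul] at hdiv
  omega
end

section
/- Let r be a positive integer and m a natural number. Then {m}_r! = s_1^{h_r(m)} · φ_r( ∏_{j=0}^{r−1} {⌈(m ∸ j)/r⌉}! ), where h_r(m) = ∑_{i=1}^{m} ((i−1) mod r), the factorials inside φ_r are Lucas factorials, and m ∸ j is truncated natural subtraction. -/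
open MvPolynomial Finset

theorem rLucas_eq_phi_luc (r : ℕ) (hr : 0 < r) (L : ℕ → MvPolynomial ℕ ℤ)
    (hL0 : L 0 = 0)
    (hL1 : ∀ i, 1 ≤ i → i ≤ r → L i = X 1 ^ (i - 1))
    (hLrec : ∀ k, r < k → L k = X r * L (k - r) + X (2 * r) * L (k - 2 * r))
    (t : ℕ) (ht : t < r) (q : ℕ) :
    L (r * q + t + 1) = X 1 ^ t * phi r (luc (q + 1)) := by
  induction q using Nat.strong_induction_on with
  | _ q ih =>
    match q, ih with
    | 0, _ => simp [hL1 (t + 1) (by lia) (by lia), luc]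
    | 1, ih =>
      have h0 := ih 0 (by lia)
      rw [hLrec _ (by lia), show r * 1 + t + 1 - r = r * 0 + t + 1 by lia, h0,
        show r * 1 + t + 1 - 2 * r = 0 by lia, hL0]
      simp [luc, phi]
      ring
    | q + 2, ih =>
      have h0 := ih q (by lia)
      have h1 := ih (q + 1) (by lia)
      have e : r * (q + 2) = r * q + 2 * r := by ring
      have e' : r * (q + 1) = r * q + r := by ring
      rw [hLrec _ (by lia), show r * (q + 2) + t + 1 - r = r * (q + 1) + t + 1 by lia, h1,
        show r * (q + 2) + t + 1 - 2 * r = r * q + t + 1 by lia, h0,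
        show luc (q + 2 + 1) = X 1 * luc (q + 1 + 1) + X 2 * luc (q + 1) from luc.eq_3 (q + 1)]
      simp only [map_add, map_mul, phi, aeval_X]
      rw [mul_one, mul_comm r 2]
      ring

theorem lucFact_succ (m : ℕ) : lucFact (m + 1) = lucFact m * luc (m + 1) := by
  simp [lucFact, Finset.prod_range_succ]

theorem lucFact_ceil_succ (r m j : ℕ) (hj : j < r) :
    lucFact ((m + 1 - j + r - 1) / r) =
      lucFact ((m - j + r - 1) / r) * if m % r = j then luc (m / r + 1) else 1 := by
  have hr : 0 < r := by lia
  have key : ∀ a c : ℕ, c < r → (r * a + c) / r = a := fun a c hc => by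
    rw [Nat.mul_add_div hr, Nat.div_eq_of_lt hc, add_zero]
  have hm := Nat.div_add_mod m r
  have ht := Nat.mod_lt m hr
  generalize m / r = q at *
  generalize m % r = t at *
  have e : r * (q + 1) = r * q + r := by ring
  rcases lt_trichotomy j t with h | h | h
  · rw [show m + 1 - j + r - 1 = r * (q + 1) + (t - j) by lia,
      show m - j + r - 1 = r * (q + 1) + (t - j - 1) by lia,
      key _ _ (by lia), key _ _ (by lia), if_neg (by lia), mul_one]
  · rw [show m + 1 - j + r - 1 = r * (q + 1) + 0 by lia,
      show m - j + r - 1 = r * q + (r - 1) by lia,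
      key _ _ (by lia), key _ _ (by lia), if_pos h.symm, lucFact_succ]
  · rw [if_neg (by lia), mul_one]
    rcases Nat.eq_zero_or_pos q with rfl | hq
    · rw [show m + 1 - j + r - 1 = m - j + r - 1 by lia]
    · have : r ≤ r * q := Nat.le_mul_of_pos_right r hq
      rw [show m + 1 - j + r - 1 = r * q + (r - (j - t)) by lia,
        show m - j + r - 1 = r * q + (r - 1 - (j - t)) by lia,
        key _ _ (by lia), key _ _ (by lia)]

/-- `{m}_r! = s₁^{h_r(m)} · φ_r(∏_{j=0}^{r−1} {⌈(m ∸ j)/r⌉}!)`, where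
`h_r(m) = ∑_{i=1}^{m} ((i−1) mod r)` and `⌈a/r⌉ = (a + r − 1) div r`. -/
theorem rLucas_factorial_eq (r : ℕ) (hr : 0 < r) (m : ℕ)
    (L : ℕ → MvPolynomial ℕ ℤ)
    (hL0 : L 0 = 0)
    (hL1 : ∀ i, 1 ≤ i → i ≤ r → L i = X 1 ^ (i - 1))
    (hLrec : ∀ k, r < k → L k = X r * L (k - r) + X (2 * r) * L (k - 2 * r)) :
    ∏ j ∈ Finset.range m, L (j + 1)
      = X 1 ^ (∑ i ∈ Finset.range m, i % r)
        * phi r (∏ j ∈ Finset.range r, lucFact ((m - j + r - 1) / r)) := by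
  induction m with
  | zero =>
    have h : ∀ j, (0 - j + r - 1) / r = 0 := fun j => Nat.div_eq_of_lt (by lia)
    simp only [h]
    simp [lucFact]
  | succ m ih =>
    have hL : L (m + 1) = X 1 ^ (m % r) * phi r (luc (m / r + 1)) := by
      rw [← rLucas_eq_phi_luc r hr L hL0 hL1 hLrec _ (Nat.mod_lt m hr), Nat.div_add_mod]
    have hprod : ∏ j ∈ Finset.range r, lucFact ((m + 1 - j + r - 1) / r) =
        (∏ j ∈ Finset.range r, lucFact ((m - j + r - 1) / r)) * luc (m / r + 1) := by
      rw [Finset.prod_congr rfl fun j hj =>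
          lucFact_ceil_succ r m j (Finset.mem_range.mp hj), Finset.prod_mul_distrib,
        Finset.prod_ite_eq, if_pos (Finset.mem_range.mpr (Nat.mod_lt m hr))]
    rw [Finset.prod_range_succ, ih, Finset.sum_range_succ, hL, hprod, map_mul, pow_add]
    ring
end

section
/- Let r be a positive integer and let m = n + k for natural numbers n, k. Then there exist functions M, N, K : Fin r → ℕ such that: the multiset {M_0, …, M_{r−1}} equals the multiset {⌈(m ∸ j)/r⌉ : 0 ≤ j ≤ r−1}, the multiset {N_0, …, N_{r−1}} equals the multiset {⌈(n ∸ j)/r⌉ : 0 ≤ j ≤ r−1}, the multiset {K_0, …, K_{r−1}} equals the multiset {⌈(k ∸ j)/r⌉ : 0 ≤ j ≤ r−1}, and M_i = N_i + K_i for every i. -/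
open Finset

theorem map_univ_val_fin_eq_map_range {α : Type*} (r : ℕ) (f : ℕ → α) :
    Multiset.map (fun i : Fin r => f i) Finset.univ.val
      = Multiset.map f (Multiset.range r) := by
  have h : (Finset.univ.map (Fin.valEmbedding (n := r))).val = Multiset.range r := by
    rw [Fin.map_valEmbedding_univ, Nat.Iio_eq_range, Finset.range_val]
  rw [← h, Finset.map_val, Multiset.map_map]
  rfl

theorem sub_ceilDiv_eq_div_add_ite {r j : ℕ} (n : ℕ) (hj : j < r) :
    (n - j + r - 1) / r = n / r + if j < n % r then 1 else 0 := by
  have hr : 0 < r := by omega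
  have hn := Nat.div_add_mod n r
  have ha := Nat.mod_lt n hr
  rcases lt_or_ge n j with h | h
  · rw [Nat.div_eq_of_lt (by omega : n < r), Nat.mod_eq_of_lt (by omega : n < r),
      Nat.div_eq_of_lt (by omega), if_neg (by omega)]
  · have e : n - j + r - 1 = r * (n / r) + (n % r + r - 1 - j) := by omega
    rw [e, Nat.mul_add_div hr]
    congr 1
    split_ifs with hja
    · exact Nat.div_eq_of_lt_le (by omega) (by omega)
    · exact Nat.div_eq_of_lt (by omega)

/-- Rotating the ceilings of `k` by the residue of `n` makes them add up termwise with those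
of `n` to those of `n + k`. -/
theorem sub_ceilDiv_add_rotate {r i : ℕ} (n k : ℕ) (hi : i < r) :
    (n + k - i + r - 1) / r
      = (n - i + r - 1) / r + (k - (i + (r - n % r)) % r + r - 1) / r := by
  have hr : 0 < r := by omega
  have ha := Nat.mod_lt n hr
  have hb := Nat.mod_lt k hr
  rw [sub_ceilDiv_eq_div_add_ite _ hi, sub_ceilDiv_eq_div_add_ite _ hi,
    sub_ceilDiv_eq_div_add_ite _ (Nat.mod_lt _ hr), Nat.add_div hr, Nat.add_mod n k r]
  have hσ : (i + (r - n % r)) % r = if i < n % r then i + (r - n % r) else i - n % r := by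
    split_ifs with h
    · exact Nat.mod_eq_of_lt (by omega)
    · rw [show i + (r - n % r) = i - n % r + r by omega, Nat.add_mod_right]
      exact Nat.mod_eq_of_lt (by omega)
  have hab : (n % r + k % r) % r
      = if r ≤ n % r + k % r then n % r + k % r - r else n % r + k % r := by
    split_ifs with h
    · rw [Nat.mod_eq_sub_mod h]
      exact Nat.mod_eq_of_lt (by omega)
    · exact Nat.mod_eq_of_lt (by omega)
  rw [hσ, hab]
  split_ifs <;> omega

/-- Theorem (matching of multisets): if `m = n + k` then the multisets
`{⌈(m ∸ j)/r⌉ : 0 ≤ j ≤ r−1}`, `{⌈(n ∸ j)/r⌉ : 0 ≤ j ≤ r−1}` and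
`{⌈(k ∸ j)/r⌉ : 0 ≤ j ≤ r−1}` can be ordered as `M`, `N`, `K` with `M_i = N_i + K_i`. -/
theorem multiset_matching (r n k : ℕ) (hr : 0 < r) :
    ∃ M N K : Fin r → ℕ,
      (Multiset.map (fun i : Fin r => M i) Finset.univ.val
          = Multiset.map (fun j => (n + k - j + r - 1) / r) (Multiset.range r)) ∧
      (Multiset.map (fun i : Fin r => N i) Finset.univ.val
          = Multiset.map (fun j => (n - j + r - 1) / r) (Multiset.range r)) ∧
      (Multiset.map (fun i : Fin r => K i) Finset.univ.val
          = Multiset.map (fun j => (k - j + r - 1) / r) (Multiset.range r)) ∧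
      ∀ i : Fin r, M i = N i + K i := by
  have : NeZero r := ⟨hr.ne'⟩
  let σ : Fin r ≃ Fin r := Equiv.addRight (Fin.ofNat r (r - n % r))
  have hσ (i : Fin r) : (σ i : ℕ) = (i + (r - n % r)) % r := by
    simp [σ, Fin.val_add]
  refine ⟨fun i => (n + k - i + r - 1) / r, fun i => (n - i + r - 1) / r,
    fun i => (k - σ i + r - 1) / r,
    map_univ_val_fin_eq_map_range r fun j => (n + k - j + r - 1) / r,
    map_univ_val_fin_eq_map_range r fun j => (n - j + r - 1) / r, ?_, fun i => ?_⟩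
  · rw [← map_univ_val_fin_eq_map_range r fun j => (k - j + r - 1) / r]
    conv_rhs => rw [← Multiset.map_univ_val_equiv σ, Multiset.map_map]
    rfl
  · simp only [hσ]
    exact sub_ceilDiv_add_rotate n k i.isLt
end

section
/- Let r be a positive integer and let n ≤ m be natural numbers. Then the product {n}_r! · {m−n}_r! divides {m}_r! in the polynomial ring ℤ[S]; that is, the r-Lucanomial {m}_r!/({n}_r!·{m−n}_r!) is a polynomial. -/
open MvPolynomial Finset

section LucasSequence

variable {R : Type*} [CommRing R]

/-- The Lucas sequence `U 0 = 0`, `U 1 = 1`, `U (k + 2) = P * U (k + 1) + Q * U k`. -/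
def lucasSeq (P Q : R) : ℕ → R
  | 0 => 0
  | 1 => 1
  | k + 2 => P * lucasSeq P Q (k + 1) + Q * lucasSeq P Q k

/-- The product of the first `n` positive-index terms of the Lucas sequence. -/
def lucasFactorial (P Q : R) (n : ℕ) : R :=
  ∏ j ∈ Finset.range n, lucasSeq P Q (j + 1)

theorem lucasFactorial_zero (P Q : R) : lucasFactorial P Q 0 = 1 := by
  simp [lucasFactorial]

theorem lucasFactorial_succ (P Q : R) (n : ℕ) :
    lucasFactorial P Q (n + 1) = lucasFactorial P Q n * lucasSeq P Q (n + 1) :=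
  Finset.prod_range_succ _ _

theorem lucasSeq_add (P Q : R) (m n : ℕ) :
    lucasSeq P Q (m + n + 1) =
      lucasSeq P Q (m + 1) * lucasSeq P Q (n + 1) + Q * lucasSeq P Q m * lucasSeq P Q n := by
  induction n generalizing m with
  | zero => simp [lucasSeq]
  | succ n ih =>
    have h := ih (m + 1)
    rw [show m + 1 + n + 1 = m + (n + 1) + 1 by ring] at h
    rw [h]
    simp only [lucasSeq]
    ring

theorem lucasFactorial_mul_dvd (P Q : R) (m n : ℕ) :
    lucasFactorial P Q m * lucasFactorial P Q n ∣ lucasFactorial P Q (m + n) := by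
  induction hs : m + n generalizing m n with
  | zero =>
    obtain ⟨rfl, rfl⟩ : m = 0 ∧ n = 0 := by omega
    simp [lucasFactorial_zero]
  | succ s ih =>
    rcases m with _ | m
    · simp [lucasFactorial_zero, ← hs]
    rcases n with _ | n
    · simp [lucasFactorial_zero, ← hs]
    obtain ⟨u, hu⟩ := ih m (n + 1) (by omega)
    obtain ⟨v, hv⟩ := ih (m + 1) n (by omega)
    have hadd := lucasSeq_add P Q (m + 1) n
    rw [show m + 1 + n + 1 = s + 1 by omega] at hadd
    refine ⟨lucasSeq P Q (m + 2) * v + Q * lucasSeq P Q n * u, ?_⟩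
    calc lucasFactorial P Q (s + 1)
        = lucasSeq P Q (m + 2) * lucasSeq P Q (n + 1) * lucasFactorial P Q s
          + Q * lucasSeq P Q (m + 1) * lucasSeq P Q n * lucasFactorial P Q s := by
          rw [lucasFactorial_succ, hadd]; ring
      _ = lucasSeq P Q (m + 2) * lucasSeq P Q (n + 1)
            * (lucasFactorial P Q (m + 1) * lucasFactorial P Q n * v)
          + Q * lucasSeq P Q (m + 1) * lucasSeq P Q n
            * (lucasFactorial P Q m * lucasFactorial P Q (n + 1) * u) := by
          rw [← hu, ← hv]
      _ = _ := by
          rw [lucasFactorial_succ P Q m, lucasFactorial_succ P Q n]; ring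

variable {r : ℕ} {x P Q : R} {L : ℕ → R}

theorem rLucas_eq_pow_mul_lucasSeq (hL0 : L 0 = 0)
    (hL1 : ∀ i, 1 ≤ i → i ≤ r → L i = x ^ (i - 1))
    (hLrec : ∀ k, r < k → L k = P * L (k - r) + Q * L (k - 2 * r))
    (q : ℕ) {i : ℕ} (hi : i < r) :
    L (q * r + i + 1) = x ^ i * lucasSeq P Q (q + 1) := by
  induction q using Nat.twoStepInduction with
  | zero =>
    rw [hL1 _ (by omega) (by omega)]
    simp [lucasSeq]
  | one =>
    rw [hLrec _ (by omega), show 1 * r + i + 1 - 2 * r = 0 by omega,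
      show 1 * r + i + 1 - r = i + 1 by omega, hL0, hL1 _ (by omega) (by omega)]
    simp [lucasSeq, mul_comm]
  | more q ih₀ ih₁ =>
    have e₀ : (q + 2) * r = q * r + 2 * r := by ring
    have e₁ : (q + 1) * r = q * r + r := by ring
    rw [hLrec _ (by omega), show (q + 2) * r + i + 1 - 2 * r = q * r + i + 1 by omega,
      show (q + 2) * r + i + 1 - r = (q + 1) * r + i + 1 by omega, ih₀, ih₁]
    simp only [lucasSeq]
    ring

theorem prod_rLucas_eq
    (hL : ∀ q i, i < r → L (q * r + i + 1) = x ^ i * lucasSeq P Q (q + 1))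
    (q i j : ℕ) (hij : i + j = r) :
    ∏ k ∈ Finset.range (q * r + i), L (k + 1) =
      x ^ (q * r.choose 2 + i.choose 2) *
        (lucasFactorial P Q q ^ j * lucasFactorial P Q (q + 1) ^ i) := by
  induction q generalizing i j with
  | zero =>
    induction i generalizing j with
    | zero => simp [lucasFactorial_zero]
    | succ i ih =>
      rw [← add_assoc, Finset.prod_range_succ, ih (j + 1) (by omega), hL _ _ (by omega),
        lucasFactorial_succ, Nat.choose_succ_succ' i 1, Nat.choose_one_right,
        lucasFactorial_zero]
      ring
  | succ q ihq =>
    induction i generalizing j with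
    | zero =>
      obtain rfl : j = r := by omega
      have h := ihq j 0 (by omega)
      rw [show (q + 1) * j + 0 = q * j + j by ring, h]
      simp [add_mul]
    | succ i ih =>
      rw [← add_assoc, Finset.prod_range_succ, ih (j + 1) (by omega), hL _ _ (by omega),
        lucasFactorial_succ P Q (q + 1), Nat.choose_succ_succ' i 1, Nat.choose_one_right]
      ring

theorem choose_two_add (a b : ℕ) :
    (a + b).choose 2 = a.choose 2 + b.choose 2 + a * b := by
  induction b with
  | zero => simp
  | succ b ih =>
    rw [← add_assoc, Nat.choose_succ_succ' (a + b) 1, Nat.choose_succ_succ' b 1, ih]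
    simp only [Nat.choose_one_right]
    ring

theorem prod_rLucas_mul_dvd (hr : 0 < r)
    (hL : ∀ q i, i < r → L (q * r + i + 1) = x ^ i * lucasSeq P Q (q + 1)) (n k : ℕ) :
    (∏ j ∈ Finset.range n, L (j + 1)) * (∏ j ∈ Finset.range k, L (j + 1))
      ∣ ∏ j ∈ Finset.range (n + k), L (j + 1) := by
  obtain ⟨p, a, ha, rfl⟩ : ∃ p a, a < r ∧ n = p * r + a :=
    ⟨n / r, n % r, Nat.mod_lt _ hr, by rw [mul_comm, Nat.div_add_mod]⟩
  obtain ⟨q, b, hb, rfl⟩ : ∃ q b, b < r ∧ k = q * r + b :=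
    ⟨k / r, k % r, Nat.mod_lt _ hr, by rw [mul_comm, Nat.div_add_mod]⟩
  have h₀₀ := lucasFactorial_mul_dvd P Q p q
  have h₁₀ := lucasFactorial_mul_dvd P Q (p + 1) q
  have h₀₁ := lucasFactorial_mul_dvd P Q p (q + 1)
  have h₁₁ := lucasFactorial_mul_dvd P Q (p + 1) (q + 1)
  rw [show p + 1 + q = p + q + 1 by ring] at h₁₀
  rw [show p + (q + 1) = p + q + 1 by ring] at h₀₁
  rw [show p + 1 + (q + 1) = p + q + 1 + 1 by ring] at h₁₁
  rcases le_total (a + b) r with hab | hab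
  · obtain ⟨c, rfl⟩ := Nat.exists_eq_add_of_le hab
    rw [show p * (a + b + c) + a + (q * (a + b + c) + b) = (p + q) * (a + b + c) + (a + b) by ring,
      prod_rLucas_eq hL p a (b + c) (by ring), prod_rLucas_eq hL q b (a + c) (by ring),
      prod_rLucas_eq hL (p + q) (a + b) c rfl]
    have hU := mul_dvd_mul (pow_dvd_pow_of_dvd h₀₀ c)
      (mul_dvd_mul (pow_dvd_pow_of_dvd h₁₀ a) (pow_dvd_pow_of_dvd h₀₁ b))
    have hx : x ^ ((p * (a + b + c).choose 2 + a.choose 2)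
        + (q * (a + b + c).choose 2 + b.choose 2)) ∣
        x ^ ((p + q) * (a + b + c).choose 2 + (a + b).choose 2) := by
      apply pow_dvd_pow
      rw [choose_two_add a b, add_mul]
      omega
    convert mul_dvd_mul hx hU using 1 <;> ring
  · obtain ⟨d, hd⟩ := Nat.exists_eq_add_of_le hab
    obtain ⟨u, rfl⟩ : ∃ u, a = d + u := Nat.exists_eq_add_of_le (by omega)
    obtain ⟨v, rfl⟩ : ∃ v, b = d + v := Nat.exists_eq_add_of_le (by omega)
    obtain rfl : r = d + u + v := by omega
    rw [show p * (d + u + v) + (d + u) + (q * (d + u + v) + (d + v))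
        = (p + q + 1) * (d + u + v) + d by ring,
      prod_rLucas_eq hL p (d + u) v (by ring), prod_rLucas_eq hL q (d + v) u (by ring),
      prod_rLucas_eq hL (p + q + 1) d (u + v) (by ring)]
    have hU := mul_dvd_mul (pow_dvd_pow_of_dvd h₁₁ d)
      (mul_dvd_mul (pow_dvd_pow_of_dvd h₁₀ u) (pow_dvd_pow_of_dvd h₀₁ v))
    have hx : x ^ ((p * (d + u + v).choose 2 + (d + u).choose 2)
        + (q * (d + u + v).choose 2 + (d + v).choose 2)) ∣
        x ^ ((p + q + 1) * (d + u + v).choose 2 + d.choose 2) := by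
      apply pow_dvd_pow
      have h : (d + u).choose 2 + (d + v).choose 2 ≤ (d + u + v).choose 2 + d.choose 2 := by
        rw [choose_two_add (d + u) v, choose_two_add d v, add_mul]
        omega
      rw [add_mul, add_mul]
      omega
    convert mul_dvd_mul hx hU using 1 <;> ring

end LucasSequence

/-- The `r`-Lucanomial `{m}_r!/({n}_r!·{m−n}_r!)` is a polynomial: `{n}_r! · {m−n}_r!`
divides `{m}_r!` in `ℤ[S]`, where `{m}_r! = ∏_{j=1}^m {j}_r`. -/
theorem rLucanomial_is_polynomial (r : ℕ) (hr : 0 < r) (m n : ℕ) (hnm : n ≤ m)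
    (L : ℕ → MvPolynomial ℕ ℤ)
    (hL0 : L 0 = 0)
    (hL1 : ∀ i, 1 ≤ i → i ≤ r → L i = X 1 ^ (i - 1))
    (hLrec : ∀ k, r < k → L k = X r * L (k - r) + X (2 * r) * L (k - 2 * r)) :
    (∏ j ∈ Finset.range n, L (j + 1)) * (∏ j ∈ Finset.range (m - n), L (j + 1))
      ∣ ∏ j ∈ Finset.range m, L (j + 1) := by
  obtain ⟨k, rfl⟩ := Nat.exists_eq_add_of_le hnm
  rw [Nat.add_sub_cancel_left]
  exact prod_rLucas_mul_dvd hr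
    (fun q _ hi => rLucas_eq_pow_mul_lucasSeq hL0 hL1 hLrec q hi) n k
end

section
/- Let R = (r_1, …, r_ℓ) be a strictly decreasing sequence of positive integers. For a natural number m, define the set Δ_{m,R} of lists of positive integers recursively: Δ_{m,∅} consists of the single list of m copies of 1, and for R = r_1 :: R', Δ_{m,R} consists of all lists w ++ t where w ∈ Δ_{m mod r_1, R'} and t is a list of entries from {r_1, 2r_1} whose sum is m − (m mod r_1). Then for every m, {m+1}_R = ∑_{T ∈ Δ_{m,R}} ∏_{i ∈ T} s_i (the sum being over the finitely many such lists). -/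
open MvPolynomial Finset

/-- The `R`-Lucas polynomials `{m}_R` for a finite sequence `R` of positive integers:
`{0}_R = 0`, `{m}_∅ = s₁^{m−1}` for `m ≥ 1`, and
`{m}_{r₁::R'} = {ε_{r₁}(m)}_{R'} · φ_{r₁}({⌈m/r₁⌉})` for `m ≥ 1`, where
`ε_r(m) = ((m−1) mod r) + 1` and `⌈m/r⌉ = (m + r − 1) div r`. -/
noncomputable def lucSeq : List ℕ → ℕ → MvPolynomial ℕ ℤ
  | _, 0 => 0
  | [], m + 1 => X 1 ^ m
  | r :: R', m + 1 => lucSeq R' (m % r + 1) * phi r (luc ((m + 1 + r - 1) / r))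

/-- The set `Δ_{m,R}` of tiling words: `Δ_{m,∅} = {1^m}`, and for `R = r :: R'`,
`Δ_{m,R}` consists of all `w ++ t` with `w ∈ Δ_{m mod r, R'}` and `t` a list with entries
from `{r, 2r}` summing to `m − (m mod r)`. -/
def InDelta : List ℕ → ℕ → List ℕ → Prop
  | [], m, T => T = List.replicate m 1
  | r :: R', m, T => ∃ w t : List ℕ, InDelta R' (m % r) w ∧
      (∀ i ∈ t, i = r ∨ i = 2 * r) ∧ t.sum = m - m % r ∧ T = w ++ t

theorem phi_X (r i : ℕ) : phi r (X i) = X (r * i) := by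
  simp [phi]

/-- `φ_r({k+1})` is the generating polynomial of the words in `r`, `2r` with sum `r k`. -/
theorem exists_finset_phi_luc (r : ℕ) (hr : 0 < r) (k : ℕ) :
    ∃ F : Finset (List ℕ),
      (∀ t, t ∈ F ↔ (∀ i ∈ t, i = r ∨ i = 2 * r) ∧ t.sum = r * k) ∧
      phi r (luc (k + 1)) = ∑ t ∈ F, (t.map fun i => (X i : MvPolynomial ℕ ℤ)).prod := by
  induction k using Nat.twoStepInduction with
  | zero =>
    refine ⟨{[]}, fun t => ?_, by simp [luc]⟩
    cases t with
    | nil => simp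
    | cons a t =>
      simp only [mem_singleton, reduceCtorEq, List.forall_mem_cons, List.sum_cons, mul_zero,
        false_iff]
      rintro ⟨⟨h, -⟩, h'⟩
      omega
  | one =>
    refine ⟨{[r]}, fun t => ?_, by simp [luc, phi_X]⟩
    rcases t with _ | ⟨a, _ | ⟨b, t⟩⟩
    · simp [hr.ne]
    · simp only [mem_singleton, List.cons.injEq, and_true, List.forall_mem_cons, List.sum_cons,
        List.sum_nil, mul_one, List.not_mem_nil, false_imp_iff, implies_true]
      omega
    · simp only [mem_singleton, List.cons.injEq, reduceCtorEq, and_false, List.forall_mem_cons,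
        List.sum_cons, mul_one, false_iff]
      rintro ⟨⟨h, h', -⟩, hs⟩
      omega
  | more k ih₀ ih₁ =>
    obtain ⟨F₀, hF₀, hs₀⟩ := ih₀
    obtain ⟨F₁, hF₁, hs₁⟩ := ih₁
    refine ⟨F₁.image (r :: ·) ∪ F₀.image (2 * r :: ·), fun t => ?_, ?_⟩
    · cases t with
      | nil => simp [hr.ne']
      | cons a t =>
        simp only [mem_union, mem_image, List.cons.injEq, hF₀, hF₁, List.forall_mem_cons,
          List.sum_cons, mul_add, mul_one]
        constructor
        · rintro (⟨t, ⟨h, hs⟩, rfl, rfl⟩ | ⟨t, ⟨h, hs⟩, rfl, rfl⟩)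
          · exact ⟨⟨Or.inl rfl, h⟩, by omega⟩
          · exact ⟨⟨Or.inr rfl, h⟩, by omega⟩
        · rintro ⟨⟨rfl | rfl, h⟩, hs⟩
          · exact Or.inl ⟨t, ⟨h, by omega⟩, rfl, rfl⟩
          · exact Or.inr ⟨t, ⟨h, by omega⟩, rfl, rfl⟩
    · rw [sum_union, sum_image (by simp), sum_image (by simp)]
      · simp only [List.map_cons, List.prod_cons, ← mul_sum, ← hs₀, ← hs₁]
        simp [luc, phi_X, mul_comm r 2]
      · simp only [disjoint_left, mem_image]
        rintro _ ⟨t, -, rfl⟩ ⟨u, -, h⟩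
        simp only [List.cons.injEq] at h
        omega

theorem InDelta.sum_eq {R : List ℕ} {m : ℕ} {T : List ℕ} (h : InDelta R m T) : T.sum = m := by
  induction R generalizing m T with
  | nil =>
    obtain rfl := h
    simp
  | cons r R ih =>
    obtain ⟨w, t, hw, -, hs, rfl⟩ := h
    rw [List.sum_append, ih hw, hs]
    exact Nat.add_sub_cancel' (Nat.mod_le m r)

/-- A word splits in at most one way into a prefix of prescribed sum and a suffix of positive
entries. -/
theorem List.append_inj_of_sum_eq {w t w' t' : List ℕ} (h : w ++ t = w' ++ t')
    (hs : w.sum = w'.sum) (ht : ∀ i ∈ t, 0 < i) (ht' : ∀ i ∈ t', 0 < i) :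
    w = w' ∧ t = t' := by
  have eq_nil {u : List ℕ} (hu : ∀ i ∈ u, 0 < i) (h₀ : u.sum = 0) : u = [] := by
    rw [List.sum_eq_zero_iff] at h₀
    exact List.eq_nil_iff_forall_not_mem.2 fun i hi => (hu i hi).ne' (h₀ i hi)
  rcases List.append_eq_append_iff.1 h with ⟨u, rfl, rfl⟩ | ⟨u, rfl, rfl⟩
  · obtain rfl : u = [] := eq_nil (fun i hi => ht i (by simp [hi])) (by simpa using hs)
    simp
  · obtain rfl : u = [] := eq_nil (fun i hi => ht' i (by simp [hi])) (by simpa using hs)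
    simp

/-- `Δ_{m,R}` is finite and its generating polynomial is `{m+1}_R`. -/
theorem exists_finset_lucSeq (R : List ℕ) (hpos : ∀ x ∈ R, 0 < x) (m : ℕ) :
    ∃ F : Finset (List ℕ), (∀ T, T ∈ F ↔ InDelta R m T) ∧
      lucSeq R (m + 1) = ∑ T ∈ F, (T.map fun i => (X i : MvPolynomial ℕ ℤ)).prod := by
  induction R generalizing m with
  | nil => exact ⟨{List.replicate m 1}, by simp [InDelta], by simp [lucSeq]⟩
  | cons r R ih =>
    rw [List.forall_mem_cons] at hpos
    obtain ⟨hr, hR⟩ := hpos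
    obtain ⟨F, hF, hFs⟩ := ih hR (m % r)
    obtain ⟨G, hG, hGs⟩ := exists_finset_phi_luc r hr (m / r)
    have hm : m - m % r = r * (m / r) := by
      have := Nat.mod_add_div m r
      omega
    have hq : (m + 1 + r - 1) / r = m / r + 1 := by
      rw [show m + 1 + r - 1 = m + r by omega, Nat.add_div_right m hr]
    refine ⟨(F ×ˢ G).image fun p => p.1 ++ p.2, fun T => ?_, ?_⟩
    · simp only [mem_image, mem_product, Prod.exists, hF, hG, InDelta, hm]
      constructor
      · rintro ⟨w, t, ⟨hw, ht, hs⟩, rfl⟩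
        exact ⟨w, t, hw, ht, hs, rfl⟩
      · rintro ⟨w, t, hw, ht, hs, rfl⟩
        exact ⟨w, t, ⟨hw, ht, hs⟩, rfl⟩
    · have pos {t : List ℕ} (ht : t ∈ G) : ∀ i ∈ t, 0 < i := fun i hi => by
        have := ((hG t).1 ht).1 i hi
        omega
      rw [sum_image]
      · simp only [lucSeq, hq, hFs, hGs, sum_mul_sum, sum_product, List.map_append,
          List.prod_append]
      · rintro ⟨w, t⟩ h ⟨w', t'⟩ h' heq
        simp only [coe_product, Set.mem_prod, mem_coe] at h h'
        obtain ⟨rfl, rfl⟩ := List.append_inj_of_sum_eq heq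
          (((hF w).1 h.1).sum_eq.trans ((hF w').1 h'.1).sum_eq.symm) (pos h.2) (pos h'.2)
        rfl

/-- `{m+1}_R = ∑_{T ∈ Δ_{m,R}} ∏_{i ∈ T} s_i`. -/
theorem lucSeq_eq_sum_tilings (R : List ℕ) (hpos : ∀ x ∈ R, 0 < x)
    (hdec : R.Chain' (· > ·)) (m : ℕ) (𝒯 : Finset (List ℕ))
    (h𝒯 : ∀ T : List ℕ, T ∈ 𝒯 ↔ InDelta R m T) :
    lucSeq R (m + 1) = ∑ T ∈ 𝒯, (T.map fun i => (X i : MvPolynomial ℕ ℤ)).prod := by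
  obtain ⟨F, hF, hFs⟩ := exists_finset_lucSeq R hpos m
  obtain rfl : 𝒯 = F := by
    ext T
    rw [h𝒯, hF]
  exact hFs
end

section
/- Let R = (r_1, …, r_ℓ) be a strictly decreasing sequence of positive integers and let 1 ≤ n < m be natural numbers. Define the sequences ν_1 = m, ν_{i+1} = ε_{r_i}(ν_i); α_1 = n, α_{i+1} = ε_{r_i}(α_i); β_1 = m − n, β_{i+1} = ε_{r_i}(β_i), for 1 ≤ i ≤ ℓ. If ν_i = α_i + β_i for every 1 ≤ i ≤ ℓ+1, then {n}_R! · {m−n}_R! divides {m}_R! in ℤ[S]; that is, the R-Lucanomial {m}_R!/({n}_R!·{m−n}_R!) is a polynomial. -/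
open MvPolynomial Finset

/-- The chain `[ν₁, ν₂, …, ν_{ℓ+1}]` where `ν₁ = m` and `ν_{i+1} = ε_{r_i}(ν_i)`,
with `ε_r(m) = ((m−1) mod r) + 1`. -/
def epsChain : List ℕ → ℕ → List ℕ
  | [], m => [m]
  | r :: R', m => m :: epsChain R' ((m - 1) % r + 1)

theorem luc_add_add_one (m n : ℕ) :
    luc (m + n + 1) = luc (m + 1) * luc (n + 1) + X 2 * luc m * luc n := by
  induction n using Nat.twoStepInduction with
  | zero => simp [luc]
  | one => simp [luc]; ring
  | more n ih₀ ih₁ =>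
    have h : luc (m + (n + 2) + 1) = X 1 * luc (m + (n + 1) + 1) + X 2 * luc (m + n + 1) := rfl
    have h' : luc (n + 2 + 1) = X 1 * luc (n + 1 + 1) + X 2 * luc (n + 1) := rfl
    have h'' : luc (n + 2) = X 1 * luc (n + 1) + X 2 * luc n := rfl
    rw [h, ih₀, ih₁, h', h'']
    ring

/-- The factorial `{n}! = {1}{2}⋯{n}` of the Lucas polynomials. -/
noncomputable def lucFactorial (n : ℕ) : MvPolynomial ℕ ℤ :=
  ∏ j ∈ range n, luc (j + 1)

theorem lucFactorial_zero : lucFactorial 0 = 1 := by simp [lucFactorial]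

theorem lucFactorial_succ (n : ℕ) : lucFactorial (n + 1) = lucFactorial n * luc (n + 1) :=
  prod_range_succ _ _

theorem lucFactorial_mul_dvd (n k : ℕ) :
    lucFactorial n * lucFactorial k ∣ lucFactorial (n + k) := by
  induction n generalizing k with
  | zero => simp [lucFactorial_zero]
  | succ n ihn =>
    induction k with
    | zero => simp [lucFactorial_zero]
    | succ k ihk =>
      obtain ⟨c, hc⟩ := ihn (k + 1)
      obtain ⟨d, hd⟩ := ihk
      rw [show n + 1 + k = n + (k + 1) by ring] at hd
      rw [show n + 1 + (k + 1) = n + (k + 1) + 1 by ring, lucFactorial_succ (n + (k + 1)),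
        luc_add_add_one]
      refine ⟨c * luc (k + 2) + X 2 * luc n * d, ?_⟩
      calc _ = lucFactorial (n + (k + 1)) * (luc (n + 1) * luc (k + 2))
            + lucFactorial (n + (k + 1)) * (X 2 * luc n * luc (k + 1)) := by ring
        _ = lucFactorial n * lucFactorial (k + 1) * c * (luc (n + 1) * luc (k + 2))
            + lucFactorial (n + 1) * lucFactorial k * d * (X 2 * luc n * luc (k + 1)) := by
          rw [← hc, ← hd]
        _ = _ := by
          rw [lucFactorial_succ n, lucFactorial_succ k]
          ring

/-- Weighted version of the divisibility of Lucas factorials, as it appears in the block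
decomposition of `R`-Lucas factorials. -/
theorem lucFactorial_pow_mul_dvd {r s t : ℕ} (h : s + t ≤ r) (b c : ℕ) :
    lucFactorial b ^ r * luc (b + 1) ^ s * (lucFactorial c ^ r * luc (c + 1) ^ t) ∣
      lucFactorial (b + c) ^ r * luc (b + c + 1) ^ (s + t) := by
  obtain ⟨u, rfl⟩ := Nat.exists_eq_add_of_le h
  have hs := pow_dvd_pow_of_dvd (lucFactorial_mul_dvd (b + 1) c) s
  have ht := pow_dvd_pow_of_dvd (lucFactorial_mul_dvd b (c + 1)) t
  have hu := pow_dvd_pow_of_dvd (lucFactorial_mul_dvd b c) u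
  rw [show b + 1 + c = b + c + 1 by ring, lucFactorial_succ, lucFactorial_succ] at hs
  rw [← add_assoc, lucFactorial_succ, lucFactorial_succ] at ht
  convert mul_dvd_mul (mul_dvd_mul hs ht) hu using 1 <;> ring

/-- The `R`-Lucas factorial `{n}_R! = {1}_R{2}_R⋯{n}_R`. -/
noncomputable def lucSeqFactorial (R : List ℕ) (n : ℕ) : MvPolynomial ℕ ℤ :=
  ∏ j ∈ range n, lucSeq R (j + 1)

theorem lucSeq_cons_mul_add_succ {r : ℕ} (R : List ℕ) (q : ℕ) {j : ℕ} (hj : j < r) :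
    lucSeq (r :: R) (r * q + j + 1) = lucSeq R (j + 1) * phi r (luc (q + 1)) := by
  have hr : 0 < r := by omega
  have hdiv : (r * q + j + 1 + r - 1) / r = q + 1 := by
    rw [show r * q + j + 1 + r - 1 = j + r * (q + 1) by rw [mul_add]; omega,
      Nat.add_mul_div_left _ _ hr, Nat.div_eq_of_lt hj, zero_add]
  rw [lucSeq, hdiv, Nat.mul_add_mod, Nat.mod_eq_of_lt hj]

theorem lucSeqFactorial_cons_mul_add {r s : ℕ} (R : List ℕ) (q : ℕ) (hs : s ≤ r) :
    lucSeqFactorial (r :: R) (r * q + s) = lucSeqFactorial (r :: R) (r * q) *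
      (lucSeqFactorial R s * phi r (luc (q + 1)) ^ s) := by
  rw [lucSeqFactorial, prod_range_add]
  congr 1
  rw [prod_congr rfl fun j hj ↦
    lucSeq_cons_mul_add_succ R q ((mem_range.mp hj).trans_le hs), prod_mul_distrib]
  simp [lucSeqFactorial]

theorem lucSeqFactorial_cons_mul (r : ℕ) (R : List ℕ) (q : ℕ) :
    lucSeqFactorial (r :: R) (r * q) =
      lucSeqFactorial R r ^ q * phi r (lucFactorial q) ^ r := by
  induction q with
  | zero => simp [lucSeqFactorial, lucFactorial]
  | succ q ih =>
    rw [mul_add_one, lucSeqFactorial_cons_mul_add R q le_rfl, ih, lucFactorial_succ, map_mul]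
    ring

theorem lucSeqFactorial_cons {r s : ℕ} (R : List ℕ) (q : ℕ) (hs : s ≤ r) :
    lucSeqFactorial (r :: R) (r * q + s) = lucSeqFactorial R r ^ q * lucSeqFactorial R s *
      phi r (lucFactorial q ^ r * luc (q + 1) ^ s) := by
  rw [lucSeqFactorial_cons_mul_add R q hs, lucSeqFactorial_cons_mul, map_mul, map_pow, map_pow]
  ring

theorem epsChain_eq_cons (R : List ℕ) (m : ℕ) : ∃ l, epsChain R m = m :: l := by
  cases R <;> exact ⟨_, rfl⟩

theorem eq_add_of_epsChain_eq {R : List ℕ} {m n k : ℕ}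
    (h : epsChain R m = List.zipWith (· + ·) (epsChain R n) (epsChain R k)) : m = n + k := by
  obtain ⟨l, hl⟩ := epsChain_eq_cons R m
  obtain ⟨l₁, hl₁⟩ := epsChain_eq_cons R n
  obtain ⟨l₂, hl₂⟩ := epsChain_eq_cons R k
  rw [hl, hl₁, hl₂, List.zipWith_cons_cons] at h
  exact (List.cons.inj h).1

theorem lucSeqFactorial_nil_mul_dvd (n k : ℕ) :
    lucSeqFactorial [] n * lucSeqFactorial [] k ∣ lucSeqFactorial [] (n + k) := by
  rw [lucSeqFactorial, lucSeqFactorial, lucSeqFactorial, prod_range_add]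
  refine mul_dvd_mul_left _ (prod_dvd_prod_of_dvd _ _ fun j _ ↦ ?_)
  simp only [lucSeq]
  exact pow_dvd_pow _ (by omega)

theorem lucSeqFactorial_mul_dvd (R : List ℕ) (hpos : ∀ x ∈ R, 0 < x) {m n k : ℕ}
    (hm : 0 < m) (hn : 0 < n) (hk : 0 < k)
    (h : epsChain R m = List.zipWith (· + ·) (epsChain R n) (epsChain R k)) :
    lucSeqFactorial R n * lucSeqFactorial R k ∣ lucSeqFactorial R m := by
  induction R generalizing m n k with
  | nil =>
    rw [eq_add_of_epsChain_eq h]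
    exact lucSeqFactorial_nil_mul_dvd n k
  | cons r R ih =>
    have hr : 0 < r := hpos r (by simp)
    have hmnk := eq_add_of_epsChain_eq h
    have htail := (List.cons.inj h).2
    have hres := eq_add_of_epsChain_eq htail
    have hR := ih (fun x hx ↦ hpos x (by simp [hx])) (Nat.add_one_pos _) (Nat.add_one_pos _)
      (Nat.add_one_pos _) htail
    have key : ∀ x, 0 < x → ∃ q s, s ≤ r ∧ (x - 1) % r + 1 = s ∧ x = r * q + s := by
      intro x hx
      refine ⟨(x - 1) / r, _, Nat.mod_lt _ hr, rfl, ?_⟩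
      have := Nat.div_add_mod (x - 1) r
      omega
    obtain ⟨a, u, hu, hmu, hma⟩ := key m hm
    obtain ⟨b, s, hs, hns, hnb⟩ := key n hn
    obtain ⟨c, t, ht, hkt, hkc⟩ := key k hk
    rw [hmu, hns, hkt] at hres hR
    have habc : a = b + c := by
      refine Nat.eq_of_mul_eq_mul_left hr ?_
      rw [mul_add]
      omega
    subst habc hres
    rw [hma, hnb, hkc, lucSeqFactorial_cons R _ hu, lucSeqFactorial_cons R _ hs,
      lucSeqFactorial_cons R _ ht]
    convert mul_dvd_mul (mul_dvd_mul_left (lucSeqFactorial R r ^ (b + c)) hR)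
      (map_dvd (phi r) (lucFactorial_pow_mul_dvd hu b c)) using 1
    rw [map_mul (phi r) (lucFactorial b ^ r * luc (b + 1) ^ s)]
    ring

/-- If `ν_i = α_i + β_i` for all `1 ≤ i ≤ ℓ+1` (where `ν`, `α`, `β` are the `ε`-chains of
`m`, `n` and `m−n`), then the `R`-Lucanomial `{m}_R!/({n}_R!·{m−n}_R!)` is a polynomial. -/
theorem lucSeq_binomial_is_polynomial (R : List ℕ) (hpos : ∀ x ∈ R, 0 < x)
    (hdec : R.Chain' (· > ·)) (m n : ℕ) (hn : 1 ≤ n) (hnm : n < m)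
    (hsum : epsChain R m = List.zipWith (· + ·) (epsChain R n) (epsChain R (m - n))) :
    (∏ j ∈ Finset.range n, lucSeq R (j + 1)) * (∏ j ∈ Finset.range (m - n), lucSeq R (j + 1))
      ∣ ∏ j ∈ Finset.range m, lucSeq R (j + 1) := by
  exact lucSeqFactorial_mul_dvd R hpos (by omega) hn (by omega) hsum
end

section
/- For all natural numbers n ≤ m, the product {n}! · {m−n}! divides {m}! in ℤ[s_1,s_2]; that is, the Lucanomial {m}!/({n}!·{m−n}!) is a polynomial in s_1 and s_2 with integer coefficients. -/
open MvPolynomial Finset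

/-- The Lucas polynomials in `ℤ[s₁,s₂]`, where `s₁ = X 0` and `s₂ = X 1`:
`{0} = 0`, `{1} = 1`, `{m} = s₁·{m−1} + s₂·{m−2}`. -/
noncomputable def luc2 : ℕ → MvPolynomial (Fin 2) ℤ
  | 0 => 0
  | 1 => 1
  | m + 2 => X 0 * luc2 (m + 1) + X 1 * luc2 m

theorem luc2_add_two (m : ℕ) : luc2 (m + 2) = X 0 * luc2 (m + 1) + X 1 * luc2 m := by
  rw [luc2]

/-- The addition formula `{a+b+1} = {a+1}·{b+1} + s₂·{a}·{b}`. -/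
theorem luc2_add_add_one (a b : ℕ) :
    luc2 (a + b + 1) = luc2 (a + 1) * luc2 (b + 1) + X 1 * luc2 a * luc2 b := by
  induction b generalizing a with
  | zero => simp [luc2]
  | succ b ih =>
    rw [show a + (b + 1) + 1 = (a + 1) + b + 1 by omega, ih, luc2_add_two a, luc2_add_two b]
    ring

theorem prod_luc2_mul_prod_luc2_dvd (a b : ℕ) :
    (∏ j ∈ Finset.range a, luc2 (j + 1)) * (∏ j ∈ Finset.range b, luc2 (j + 1))
      ∣ ∏ j ∈ Finset.range (a + b), luc2 (j + 1) := by
  induction a generalizing b with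
  | zero => simp
  | succ a iha =>
    induction b with
    | zero => simp
    | succ b ihb =>
      have key : luc2 (a + 1 + b + 1) =
          luc2 (a + 1) * (X 1 * luc2 b) + luc2 (b + 1) * luc2 (a + 1 + 1) := by
        rw [luc2_add_add_one]
        ring
      have h₁ := mul_dvd_mul_right (iha (b + 1)) (luc2 (a + 1))
      have h₂ := mul_dvd_mul_right ihb (luc2 (b + 1))
      rw [mul_right_comm, ← Finset.prod_range_succ, ← add_assoc, add_right_comm a b 1] at h₁
      rw [mul_assoc, ← Finset.prod_range_succ] at h₂
      rw [← add_assoc, Finset.prod_range_succ _ (a + 1 + b), key, mul_add,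
        ← mul_assoc _ (luc2 (a + 1)), ← mul_assoc _ (luc2 (b + 1))]
      exact dvd_add (h₁.mul_right _) (h₂.mul_right _)

/-- The Lucanomial `{m}!/({n}!·{m−n}!)` is a polynomial: `{n}! · {m−n}!` divides `{m}!`
in `ℤ[s₁,s₂]`, where `{m}! = {m}·{m−1}⋯{1}`. -/
theorem lucanomial_is_polynomial (m n : ℕ) (hnm : n ≤ m) :
    (∏ j ∈ Finset.range n, luc2 (j + 1)) * (∏ j ∈ Finset.range (m - n), luc2 (j + 1))
      ∣ ∏ j ∈ Finset.range m, luc2 (j + 1) := by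
  simpa only [Nat.add_sub_cancel' hnm] using prod_luc2_mul_prod_luc2_dvd n (m - n)
end
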